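/- arXiv:2402.10424 — 6 statements merged into one kernel-verified Lean document; each statement's English description precedes it below -/
import Mathlib

section
/- Let Z be a nonempty finite set, π a prior on Z, and T ≥ 1 an integer. For t = 1,…,T let a_t, b_t, c_t : Z → ℝ satisfy a_t z ≥ 0 and 0 ≤ b_t z ≤ c_t z for all z ∈ Z. Fix z* ∈ Z with π z* > 0 and a_t z* > 0, b_t z* > 0 for all t. Define M_t and N_t as in the context and set L_t := Σ_{z∈Z} π z (∏_{i=1}^{t−1} a_i z · b_i z) · a_t z · c_t z, so that L_t/N_t represents Pr(r_t | x_t, S_{t−1}). Then (1/T) Σ_{t=1}^T log(L_t/N_t) ≥ (1/T) log(π z*) + (1/T) Σ_{t=1}^T log(b_t z*) + (1/T) Σ_{t=1}^T log( a_t z* · M_{t−1} / N_t ). -/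
/-- Theorem 1 (Average ICL Likelihood) of the Pelican Soup paper, phrased for the
latent-variable mixture model over a nonempty finite latent set `Z` with prior `π`.
Here `a t z` represents `Pr(x_t | z, S_{t-1})`, `b t z` represents
`Pr(r_t, d | x_t, z, S_{t-1})`, `c t z` represents `Pr(r_t | x_t, z, S_{t-1})`,
`M t` and `N t` are the marginal sequence likelihoods, and `L t / N t` represents
`Pr(r_t | x_t, S_{t-1})`. -/
theorem pelican_soup_average_icl_likelihood
    {Z : Type*} [Fintype Z] [Nonempty Z]
    (π : Z → ℝ) (hπ0 : ∀ z, 0 ≤ π z) (hπ1 : ∑ z, π z = 1)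
    (T : ℕ) (hT : 1 ≤ T)
    (a b c : ℕ → Z → ℝ)
    (ha : ∀ t ∈ Finset.Icc 1 T, ∀ z, 0 ≤ a t z)
    (hb : ∀ t ∈ Finset.Icc 1 T, ∀ z, 0 ≤ b t z)
    (hbc : ∀ t ∈ Finset.Icc 1 T, ∀ z, b t z ≤ c t z)
    (zstar : Z) (hπz : 0 < π zstar)
    (haz : ∀ t ∈ Finset.Icc 1 T, 0 < a t zstar)
    (hbz : ∀ t ∈ Finset.Icc 1 T, 0 < b t zstar)
    (M N L : ℕ → ℝ)
    (hM : ∀ t, M t = ∑ z, π z * ∏ i ∈ Finset.Icc 1 t, (a i z * b i z))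
    (hN : ∀ t, N t = ∑ z, π z * (∏ i ∈ Finset.Icc 1 (t - 1), (a i z * b i z)) * a t z)
    (hL : ∀ t, L t = ∑ z,
      π z * (∏ i ∈ Finset.Icc 1 (t - 1), (a i z * b i z)) * a t z * c t z) :
    (1 / (T : ℝ)) * ∑ t ∈ Finset.Icc 1 T, Real.log (L t / N t) ≥
      (1 / (T : ℝ)) * Real.log (π zstar)
        + (1 / (T : ℝ)) * ∑ t ∈ Finset.Icc 1 T, Real.log (b t zstar)
        + (1 / (T : ℝ)) * ∑ t ∈ Finset.Icc 1 T,
            Real.log (a t zstar * M (t - 1) / N t) := by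
  have hmem : ∀ t ≤ T, ∀ i ∈ Finset.Icc 1 t, i ∈ Finset.Icc 1 T := fun t ht i hi =>
    Finset.Icc_subset_Icc_right ht hi
  have hP0 : ∀ t ≤ T, ∀ z, 0 ≤ π z * ∏ i ∈ Finset.Icc 1 t, (a i z * b i z) := fun t ht z =>
    mul_nonneg (hπ0 z) (Finset.prod_nonneg fun i hi =>
      mul_nonneg (ha i (hmem t ht i hi) z) (hb i (hmem t ht i hi) z))
  have hPz : ∀ t ≤ T, 0 < π zstar * ∏ i ∈ Finset.Icc 1 t, (a i zstar * b i zstar) :=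
    fun t ht => mul_pos hπz (Finset.prod_pos fun i hi =>
      mul_pos (haz i (hmem t ht i hi)) (hbz i (hmem t ht i hi)))
  have hMle : ∀ t ≤ T, π zstar * ∏ i ∈ Finset.Icc 1 t, (a i zstar * b i zstar) ≤ M t := by
    intro t ht
    rw [hM]
    exact Finset.single_le_sum (fun z _ => hP0 t ht z) (Finset.mem_univ zstar)
  have hMpos : ∀ t ≤ T, 0 < M t := fun t ht => (hPz t ht).trans_le (hMle t ht)
  have hNpos : ∀ t ∈ Finset.Icc 1 T, 0 < N t := by
    intro t ht
    have htT : t - 1 ≤ T := (Nat.sub_le t 1).trans (Finset.mem_Icc.1 ht).2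
    rw [hN]
    exact Finset.sum_pos' (fun z _ => mul_nonneg (hP0 _ htT z) (ha t ht z))
      ⟨zstar, Finset.mem_univ _, mul_pos (hPz _ htT) (haz t ht)⟩
  have hML : ∀ t ∈ Finset.Icc 1 T, M t ≤ L t := by
    intro t ht
    obtain ⟨h1, h2⟩ := Finset.mem_Icc.1 ht
    have htT : t - 1 ≤ T := (Nat.sub_le t 1).trans h2
    rw [hM, hL]
    refine Finset.sum_le_sum fun z _ => ?_
    obtain ⟨k, rfl⟩ := Nat.exists_eq_add_of_le' h1
    rw [Finset.prod_Icc_succ_top h1, ← mul_assoc, ← mul_assoc]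
    exact mul_le_mul_of_nonneg_left (hbc _ ht z) (mul_nonneg (hP0 _ htT z) (ha _ ht z))
  have hstep : ∀ t ∈ Finset.Icc 1 T,
      Real.log (b t zstar) + Real.log (a t zstar * M (t - 1) / N t)
        + (Real.log (M t) - Real.log (M (t - 1))) - Real.log (a t zstar * b t zstar)
      ≤ Real.log (L t / N t) := by
    intro t ht
    have h2 := (Finset.mem_Icc.1 ht).2
    have hMt := hMpos t h2
    have hMt' := hMpos (t - 1) ((Nat.sub_le t 1).trans h2)
    have hlog := Real.log_le_log hMt (hML t ht)
    rw [Real.log_div (hMt.trans_le (hML t ht)).ne' (hNpos t ht).ne',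
      Real.log_div (mul_pos (haz t ht) hMt').ne' (hNpos t ht).ne',
      Real.log_mul (haz t ht).ne' hMt'.ne', Real.log_mul (haz t ht).ne' (hbz t ht).ne']
    linarith
  have htel : ∀ n : ℕ, ∑ t ∈ Finset.Icc 1 n, (Real.log (M t) - Real.log (M (t - 1)))
      = Real.log (M n) - Real.log (M 0) := by
    intro n
    induction n with
    | zero => simp
    | succ n ih =>
      rw [Finset.sum_Icc_succ_top (by omega), ih, Nat.add_sub_cancel]
      ring
  have hM0 : Real.log (M 0) = 0 := by simp [hM, hπ1]
  have hMT := Real.log_le_log (hPz T le_rfl) (hMle T le_rfl)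
  rw [Real.log_mul hπz.ne' (right_ne_zero_of_mul (hPz T le_rfl).ne'),
    Real.log_prod fun i hi => (mul_pos (haz i hi) (hbz i hi)).ne'] at hMT
  have hsum := Finset.sum_le_sum hstep
  rw [Finset.sum_sub_distrib, Finset.sum_add_distrib, Finset.sum_add_distrib, htel] at hsum
  rw [ge_iff_le, ← mul_add, ← mul_add]
  exact mul_le_mul_of_nonneg_left (by linarith) (by positivity)
end

section
/- Let Z be a nonempty countable set and π : Z → ℝ a summable function with π z ≥ 0 for all z and Σ'_{z∈Z} π z = 1 (tsum). For t = 1,…,T (T ≥ 1) let a_t, b_t, c_t : Z → ℝ satisfy 0 ≤ a_t z ≤ 1 and 0 ≤ b_t z ≤ c_t z ≤ 1 for all z. Fix z* ∈ Z with π z* > 0 and a_t z* > 0, b_t z* > 0 for all t. Define M_t := Σ'_{z∈Z} π z ∏_{i=1}^{t} a_i z · b_i z (with M_0 = 1), N_t := Σ'_{z∈Z} π z (∏_{i=1}^{t−1} a_i z · b_i z) · a_t z, and L_t := Σ'_{z∈Z} π z (∏_{i=1}^{t−1} a_i z · b_i z) · a_t z · c_t z (all these sums are absolutely convergent since each summand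 is ≤ π z). Then (1/T) Σ_{t=1}^T log(L_t/N_t) ≥ (1/T) log(π z*) + (1/T) Σ_{t=1}^T log(b_t z*) + (1/T) Σ_{t=1}^T log( a_t z* · M_{t−1} / N_t ). -/
/-- Multiplying a nonnegative summable family by weights in `[0, 1]` keeps it summable. -/
lemma Summable.mul_of_mem_unit {Z : Type*} {p w : Z → ℝ} (hp : Summable p)
    (hp0 : ∀ z, 0 ≤ p z) (hw0 : ∀ z, 0 ≤ w z) (hw1 : ∀ z, w z ≤ 1) :
    Summable fun z => p z * w z :=
  hp.of_nonneg_of_le (fun z => mul_nonneg (hp0 z) (hw0 z))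
    fun z => mul_le_of_le_one_right (hp0 z) (hw1 z)

/-- A weighted sum with weights in `[0, 1]` dominates each of its terms. -/
lemma Summable.mul_le_tsum_mul_of_mem_unit {Z : Type*} {p w : Z → ℝ} (hp : Summable p)
    (hp0 : ∀ z, 0 ≤ p z) (hw0 : ∀ z, 0 ≤ w z) (hw1 : ∀ z, w z ≤ 1) (z : Z) :
    p z * w z ≤ ∑' y, p y * w y :=
  (hp.mul_of_mem_unit hp0 hw0 hw1).le_tsum z fun y _ => mul_nonneg (hp0 y) (hw0 y)

/-- Telescoping over `{1, …, n}`. -/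
lemma Finset.sum_Icc_one_sub_pred (f : ℕ → ℝ) (n : ℕ) :
    ∑ t ∈ Finset.Icc 1 n, (f t - f (t - 1)) = f n - f 0 := by
  induction n with
  | zero => simp
  | succ n ih =>
    rw [Finset.sum_Icc_succ_top (by omega), ih, Nat.add_sub_cancel]
    ring

/-- Theorem 1 of the Pelican Soup paper stated for a countably infinite latent
space `Z` of expression–meaning associations, with all marginal likelihoods
expressed via `tsum` (denoted Σ'). -/
theorem pelican_soup_average_icl_likelihood_countable
    {Z : Type*} [Countable Z] [Nonempty Z]
    (π : Z → ℝ) (hπsum : Summable π) (hπ0 : ∀ z, 0 ≤ π z) (hπ1 : ∑' z, π z = 1)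
    (T : ℕ) (hT : 1 ≤ T)
    (a b c : ℕ → Z → ℝ)
    (ha0 : ∀ t ∈ Finset.Icc 1 T, ∀ z, 0 ≤ a t z)
    (ha1 : ∀ t ∈ Finset.Icc 1 T, ∀ z, a t z ≤ 1)
    (hb0 : ∀ t ∈ Finset.Icc 1 T, ∀ z, 0 ≤ b t z)
    (hbc : ∀ t ∈ Finset.Icc 1 T, ∀ z, b t z ≤ c t z)
    (hc1 : ∀ t ∈ Finset.Icc 1 T, ∀ z, c t z ≤ 1)
    (zstar : Z) (hπz : 0 < π zstar)
    (haz : ∀ t ∈ Finset.Icc 1 T, 0 < a t zstar)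
    (hbz : ∀ t ∈ Finset.Icc 1 T, 0 < b t zstar)
    (M N L : ℕ → ℝ)
    (hM : ∀ t, M t = ∑' z, π z * ∏ i ∈ Finset.Icc 1 t, (a i z * b i z))
    (hN : ∀ t, N t = ∑' z, π z * (∏ i ∈ Finset.Icc 1 (t - 1), (a i z * b i z)) * a t z)
    (hL : ∀ t, L t = ∑' z,
      π z * (∏ i ∈ Finset.Icc 1 (t - 1), (a i z * b i z)) * a t z * c t z) :
    (1 / (T : ℝ)) * ∑ t ∈ Finset.Icc 1 T, Real.log (L t / N t) ≥
      (1 / (T : ℝ)) * Real.log (π zstar)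
        + (1 / (T : ℝ)) * ∑ t ∈ Finset.Icc 1 T, Real.log (b t zstar)
        + (1 / (T : ℝ)) * ∑ t ∈ Finset.Icc 1 T,
            Real.log (a t zstar * M (t - 1) / N t) := by
  have hab0 : ∀ t ∈ Finset.Icc 1 T, ∀ z, 0 ≤ a t z * b t z := fun t ht z =>
    mul_nonneg (ha0 t ht z) (hb0 t ht z)
  have hab1 : ∀ t ∈ Finset.Icc 1 T, ∀ z, a t z * b t z ≤ 1 := fun t ht z =>
    mul_le_one₀ (ha1 t ht z) (hb0 t ht z) ((hbc t ht z).trans (hc1 t ht z))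
  have hmem : ∀ t ≤ T, ∀ i ∈ Finset.Icc 1 t, i ∈ Finset.Icc 1 T := fun t ht i hi =>
    Finset.Icc_subset_Icc_right ht hi
  have hP0 : ∀ t ≤ T, ∀ z, 0 ≤ ∏ i ∈ Finset.Icc 1 t, (a i z * b i z) := fun t ht z =>
    Finset.prod_nonneg fun i hi => hab0 i (hmem t ht i hi) z
  have hP1 : ∀ t ≤ T, ∀ z, ∏ i ∈ Finset.Icc 1 t, (a i z * b i z) ≤ 1 := fun t ht z =>
    Finset.prod_le_one (fun i hi => hab0 i (hmem t ht i hi) z)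
      fun i hi => hab1 i (hmem t ht i hi) z
  have hPz : ∀ t ≤ T, 0 < ∏ i ∈ Finset.Icc 1 t, (a i zstar * b i zstar) := fun t ht =>
    Finset.prod_pos fun i hi => mul_pos (haz i (hmem t ht i hi)) (hbz i (hmem t ht i hi))
  have hM_ge : ∀ t ≤ T, π zstar * ∏ i ∈ Finset.Icc 1 t, (a i zstar * b i zstar) ≤ M t := by
    intro t ht
    rw [hM t]
    exact hπsum.mul_le_tsum_mul_of_mem_unit hπ0 (hP0 t ht) (hP1 t ht) zstar
  have hM_pos : ∀ t ≤ T, 0 < M t := fun t ht =>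
    (mul_pos hπz (hPz t ht)).trans_le (hM_ge t ht)
  have hM_zero : M 0 = 1 := by simp [hM, hπ1]
  have hstep : ∀ t ∈ Finset.Icc 1 T,
      Real.log (b t zstar) + Real.log (a t zstar * M (t - 1) / N t)
        + (Real.log (M t) - Real.log (M (t - 1)))
        - Real.log (a t zstar * b t zstar) ≤ Real.log (L t / N t) := by
    intro t ht
    obtain ⟨ht1, htT⟩ := Finset.mem_Icc.mp ht
    have hpred : t - 1 ≤ T := by omega
    have hq0 : ∀ z, 0 ≤ (∏ i ∈ Finset.Icc 1 (t - 1), (a i z * b i z)) * a t z := fun z =>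
      mul_nonneg (hP0 _ hpred z) (ha0 t ht z)
    have hq1 : ∀ z, (∏ i ∈ Finset.Icc 1 (t - 1), (a i z * b i z)) * a t z ≤ 1 := fun z =>
      mul_le_one₀ (hP1 _ hpred z) (ha0 t ht z) (ha1 t ht z)
    have hc0 : ∀ z, 0 ≤ c t z := fun z => (hb0 t ht z).trans (hbc t ht z)
    have hN_pos : 0 < N t := by
      have h := hπsum.mul_le_tsum_mul_of_mem_unit hπ0 hq0 hq1 zstar
      simp only [← mul_assoc, ← hN] at h
      exact (mul_pos (mul_pos hπz (hPz _ hpred)) (haz t ht)).trans_le h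
    have hML : M t ≤ L t := by
      rw [hM, hL]
      refine Summable.tsum_le_tsum (fun z => ?_)
        (hπsum.mul_of_mem_unit hπ0 (hP0 t htT) (hP1 t htT)) ?_
      · obtain ⟨s, rfl⟩ : ∃ s, t = s + 1 := ⟨t - 1, by omega⟩
        rw [Finset.prod_Icc_succ_top (by omega), Nat.add_sub_cancel]
        simp only [Nat.add_sub_cancel, ← mul_assoc] at hq0 ⊢
        refine mul_le_mul_of_nonneg_left (hbc _ ht z) ?_
        rw [mul_assoc (π z)]
        exact mul_nonneg (hπ0 z) (hq0 z)
      · simpa only [← mul_assoc] using hπsum.mul_of_mem_unit hπ0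
          (fun z => mul_nonneg (hq0 z) (hc0 z))
          fun z => mul_le_one₀ (hq1 z) (hc0 z) (hc1 t ht z)
    have hMt := hM_pos t htT
    have hMp := hM_pos (t - 1) hpred
    have hlog := Real.log_le_log hMt hML
    rw [Real.log_div (hMt.trans_le hML).ne' hN_pos.ne',
      Real.log_div (mul_pos (haz t ht) hMp).ne' hN_pos.ne',
      Real.log_mul (haz t ht).ne' hMp.ne', Real.log_mul (haz t ht).ne' (hbz t ht).ne']
    linarith
  have hsum := Finset.sum_le_sum hstep
  rw [Finset.sum_sub_distrib, Finset.sum_add_distrib, Finset.sum_add_distrib,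
    Finset.sum_Icc_one_sub_pred (fun t => Real.log (M t)), hM_zero, Real.log_one] at hsum
  have hlast := Real.log_le_log (mul_pos hπz (hPz T le_rfl)) (hM_ge T le_rfl)
  rw [Real.log_mul hπz.ne' (hPz T le_rfl).ne',
    Real.log_prod fun i hi => (mul_pos (haz i hi) (hbz i hi)).ne'] at hlast
  rw [ge_iff_le, ← mul_add, ← mul_add]
  exact mul_le_mul_of_nonneg_left (by linarith) (by positivity)
end

section
/- Let Z be a nonempty finite set, π a prior on Z, and T ≥ 1. For t = 1,…,T let a_t, b_t : Z → ℝ satisfy 0 ≤ a_t z and 0 ≤ b_t z ≤ 1 for all z ∈ Z, and fix z* ∈ Z with π z* > 0 and a_t z* > 0 for all t. Define M_t and N_t as in the context. Assume in addition that b_t z* = 1 for all t (consistency: given z* the correct verbalizer and delimiter follow each input with probability one) and that a_t z* · M_{t−1} ≥ N_t for all t (each test input is at least as likely under z* as under the predictive distribution). Then (1/T) log(π z*) ≤ (1/T) Σ_{t=1}^T log( M_t / N_t ) ≤ 0. -/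
/-- The Pelican Soup paper's claim following Theorem 1: when consistency holds
(`b t zstar = 1`) and each test input is at least as likely under the true
association `zstar` as under the predictive distribution
(`a t zstar * M (t-1) ≥ N t`), the average in-context learning log-likelihood
is sandwiched between `(1/T) * log (π zstar)` and `0`. -/
theorem pelican_soup_average_icl_loglikelihood_sandwich
    {Z : Type*} [Fintype Z] [Nonempty Z]
    (π : Z → ℝ) (hπ0 : ∀ z, 0 ≤ π z) (hπ1 : ∑ z, π z = 1)
    (T : ℕ) (hT : 1 ≤ T)
    (a b : ℕ → Z → ℝ)
    (ha0 : ∀ t ∈ Finset.Icc 1 T, ∀ z, 0 ≤ a t z)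
    (hb0 : ∀ t ∈ Finset.Icc 1 T, ∀ z, 0 ≤ b t z)
    (hb1 : ∀ t ∈ Finset.Icc 1 T, ∀ z, b t z ≤ 1)
    (zstar : Z) (hπz : 0 < π zstar)
    (haz : ∀ t ∈ Finset.Icc 1 T, 0 < a t zstar)
    (M N : ℕ → ℝ)
    (hM : ∀ t, M t = ∑ z, π z * ∏ i ∈ Finset.Icc 1 t, (a i z * b i z))
    (hN : ∀ t, N t = ∑ z, π z * (∏ i ∈ Finset.Icc 1 (t - 1), (a i z * b i z)) * a t z)
    (hbz : ∀ t ∈ Finset.Icc 1 T, b t zstar = 1)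
    (haM : ∀ t ∈ Finset.Icc 1 T, N t ≤ a t zstar * M (t - 1)) :
    (1 / (T : ℝ)) * Real.log (π zstar) ≤
        (1 / (T : ℝ)) * ∑ t ∈ Finset.Icc 1 T, Real.log (M t / N t) ∧
      (1 / (T : ℝ)) * ∑ t ∈ Finset.Icc 1 T, Real.log (M t / N t) ≤ 0 := by
  have hmem : ∀ {n i : ℕ}, n ≤ T → i ∈ Finset.Icc 1 n → i ∈ Finset.Icc 1 T := fun hn hi =>
    Finset.Icc_subset_Icc_right hn hi
  have hprod0 : ∀ n ≤ T, ∀ z, 0 ≤ ∏ i ∈ Finset.Icc 1 n, (a i z * b i z) := fun n hn z =>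
    Finset.prod_nonneg fun i hi => mul_nonneg (ha0 i (hmem hn hi) z) (hb0 i (hmem hn hi) z)
  have hprodz : ∀ n ≤ T, 0 < ∏ i ∈ Finset.Icc 1 n, a i zstar := fun n hn =>
    Finset.prod_pos fun i hi => haz i (hmem hn hi)
  have hMlower : ∀ n ≤ T, π zstar * ∏ i ∈ Finset.Icc 1 n, a i zstar ≤ M n := by
    intro n hn
    have hprod : ∏ i ∈ Finset.Icc 1 n, a i zstar =
        ∏ i ∈ Finset.Icc 1 n, (a i zstar * b i zstar) :=
      Finset.prod_congr rfl fun i hi => by rw [hbz i (hmem hn hi), mul_one]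
    rw [hM, hprod]
    exact Finset.single_le_sum
      (f := fun z => π z * ∏ i ∈ Finset.Icc 1 n, (a i z * b i z))
      (fun z _ => mul_nonneg (hπ0 z) (hprod0 n hn z)) (Finset.mem_univ zstar)
  have hMpos : ∀ n ≤ T, 0 < M n := fun n hn =>
    (mul_pos hπz (hprodz n hn)).trans_le (hMlower n hn)
  have hMN : ∀ n, n + 1 ≤ T → M (n + 1) ≤ N (n + 1) := by
    intro n hn
    have ht : n + 1 ∈ Finset.Icc 1 T := Finset.mem_Icc.mpr ⟨by omega, hn⟩
    rw [hM, hN, Nat.add_sub_cancel]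
    refine Finset.sum_le_sum fun z _ => ?_
    rw [Finset.prod_Icc_succ_top (by omega), ← mul_assoc]
    exact mul_le_mul_of_nonneg_left (mul_le_of_le_one_right (ha0 _ ht z) (hb1 _ ht z))
      (mul_nonneg (hπ0 z) (hprod0 n (by omega) z))
  have htelescope : ∀ n ≤ T, Real.log (M n) - Real.log (∏ i ∈ Finset.Icc 1 n, a i zstar) ≤
      ∑ t ∈ Finset.Icc 1 n, Real.log (M t / N t) := by
    intro n
    induction n with
    | zero => simp [hM, hπ1]
    | succ n ih =>
      intro hn
      have hn' : n ≤ T := by omega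
      have ht : n + 1 ∈ Finset.Icc 1 T := Finset.mem_Icc.mpr ⟨by omega, hn⟩
      have hNpos : 0 < N (n + 1) := (hMpos _ hn).trans_le (hMN n hn)
      have hlogN : Real.log (N (n + 1)) ≤ Real.log (a (n + 1) zstar) + Real.log (M n) := by
        rw [← Real.log_mul (haz _ ht).ne' (hMpos n hn').ne']
        exact Real.log_le_log hNpos (haM _ ht)
      rw [Finset.sum_Icc_succ_top (by omega), Finset.prod_Icc_succ_top (by omega),
        Real.log_mul (hprodz n hn').ne' (haz _ ht).ne',
        Real.log_div (hMpos _ hn).ne' hNpos.ne']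
      linarith [ih hn']
  have hT0 : (0 : ℝ) ≤ 1 / (T : ℝ) := by positivity
  refine ⟨mul_le_mul_of_nonneg_left (le_trans ?_ (htelescope T le_rfl)) hT0,
    mul_nonpos_of_nonneg_of_nonpos hT0 (Finset.sum_nonpos fun t ht => ?_)⟩
  · rw [le_sub_iff_add_le, ← Real.log_mul hπz.ne' (hprodz T le_rfl).ne']
    exact Real.log_le_log (mul_pos hπz (hprodz T le_rfl)) (hMlower T le_rfl)
  · obtain ⟨ht1, htT⟩ := Finset.mem_Icc.mp ht
    obtain ⟨n, rfl⟩ := Nat.exists_eq_add_of_le' ht1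
    have hNpos : 0 < N (n + 1) := (hMpos _ htT).trans_le (hMN n htT)
    exact Real.log_nonpos (div_nonneg (hMpos _ htT).le hNpos.le)
      (div_le_one_of_le₀ (hMN n htT) hNpos.le)
end

section
/- Let Z be a nonempty finite set, π a prior on Z, and for every t ≥ 1 let a_t, b_t : Z → ℝ satisfy 0 ≤ a_t z and 0 ≤ b_t z ≤ 1 for all z ∈ Z. Fix z* ∈ Z with π z* > 0, a_t z* > 0, b_t z* = 1 for all t, and suppose a_t z* · M_{t−1} ≥ N_t for all t, where M_t and N_t are as in the context. Then for every T ≥ 1 the average in-context learning log-likelihood A_T := (1/T) Σ_{t=1}^T log( M_t / N_t ) satisfies |A_T| ≤ (−log(π z*))/T, and consequently A_T tends to 0 as T → ∞. -/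
/-- If `M` starts at `1` and `N t ≤ c t * M (t - 1)`, the log-ratios `log (M t / N t)` telescope to
at least `log (M T) - log (∏ c t)`. -/
theorem log_sub_log_prod_le_sum_log_div {M N c : ℕ → ℝ} (hM0 : M 0 = 1) (hM : ∀ t, 0 < M t)
    (hN : ∀ t, 1 ≤ t → 0 < N t) (hc : ∀ t, 1 ≤ t → 0 < c t)
    (h : ∀ t, 1 ≤ t → N t ≤ c t * M (t - 1)) (T : ℕ) :
    Real.log (M T) - Real.log (∏ t ∈ Finset.Icc 1 T, c t) ≤
      ∑ t ∈ Finset.Icc 1 T, Real.log (M t / N t) := by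
  induction T with
  | zero => simp [hM0]
  | succ n ih =>
    have h1 : 1 ≤ n + 1 := by omega
    have hprod : 0 < ∏ t ∈ Finset.Icc 1 n, c t :=
      Finset.prod_pos fun i hi => hc i (Finset.mem_Icc.1 hi).1
    have hlog := Real.log_le_log (hN _ h1) (h _ h1)
    rw [Nat.add_sub_cancel, Real.log_mul (hc _ h1).ne' (hM n).ne'] at hlog
    rw [Finset.sum_Icc_succ_top h1, Finset.prod_Icc_succ_top h1,
      Real.log_mul hprod.ne' (hc _ h1).ne', Real.log_div (hM _).ne' (hN _ h1).ne']
    linarith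

/-- The Pelican Soup paper's statement that the average log-likelihood of
correct verbalizer predictions converges to `0` at rate `O(1/T)`: under
consistency (`b t zstar = 1`) and `a t zstar * M (t-1) ≥ N t` for all `t ≥ 1`,
the average ICL log-likelihood `A_T = (1/T) ∑_{t=1}^T log (M t / N t)`
satisfies `|A_T| ≤ (-log (π zstar)) / T` for every `T ≥ 1`, and hence tends
to `0` as `T → ∞`. -/
theorem pelican_soup_average_icl_loglikelihood_rate
    {Z : Type*} [Fintype Z] [Nonempty Z]
    (π : Z → ℝ) (hπ0 : ∀ z, 0 ≤ π z) (hπ1 : ∑ z, π z = 1)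
    (a b : ℕ → Z → ℝ)
    (ha0 : ∀ t, 1 ≤ t → ∀ z, 0 ≤ a t z)
    (hb0 : ∀ t, 1 ≤ t → ∀ z, 0 ≤ b t z)
    (hb1 : ∀ t, 1 ≤ t → ∀ z, b t z ≤ 1)
    (zstar : Z) (hπz : 0 < π zstar)
    (haz : ∀ t, 1 ≤ t → 0 < a t zstar)
    (hbz : ∀ t, 1 ≤ t → b t zstar = 1)
    (M N : ℕ → ℝ)
    (hM : ∀ t, M t = ∑ z, π z * ∏ i ∈ Finset.Icc 1 t, (a i z * b i z))
    (hN : ∀ t, N t = ∑ z, π z * (∏ i ∈ Finset.Icc 1 (t - 1), (a i z * b i z)) * a t z)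
    (haM : ∀ t, 1 ≤ t → N t ≤ a t zstar * M (t - 1)) :
    (∀ T : ℕ, 1 ≤ T →
        |(1 / (T : ℝ)) * ∑ t ∈ Finset.Icc 1 T, Real.log (M t / N t)| ≤
          (-Real.log (π zstar)) / (T : ℝ)) ∧
      Filter.Tendsto
        (fun T : ℕ => (1 / (T : ℝ)) * ∑ t ∈ Finset.Icc 1 T, Real.log (M t / N t))
        Filter.atTop (nhds 0) := by
  have hP : ∀ t z, 0 ≤ π z * ∏ i ∈ Finset.Icc 1 t, (a i z * b i z) := fun t z =>
    mul_nonneg (hπ0 z) <| Finset.prod_nonneg fun i hi =>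
      mul_nonneg (ha0 i (Finset.mem_Icc.1 hi).1 z) (hb0 i (Finset.mem_Icc.1 hi).1 z)
  have hprod : ∀ t, 0 < ∏ i ∈ Finset.Icc 1 t, a i zstar := fun t =>
    Finset.prod_pos fun i hi => haz i (Finset.mem_Icc.1 hi).1
  have hM_ge : ∀ t, π zstar * ∏ i ∈ Finset.Icc 1 t, a i zstar ≤ M t := by
    intro t
    have hstar : ∏ i ∈ Finset.Icc 1 t, a i zstar =
        ∏ i ∈ Finset.Icc 1 t, (a i zstar * b i zstar) :=
      Finset.prod_congr rfl fun i hi => by rw [hbz i (Finset.mem_Icc.1 hi).1, mul_one]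
    rw [hM, hstar]
    exact Finset.single_le_sum (f := fun z => π z * ∏ i ∈ Finset.Icc 1 t, (a i z * b i z))
      (fun z _ => hP t z) (Finset.mem_univ zstar)
  have hM_pos : ∀ t, 0 < M t := fun t => (mul_pos hπz (hprod t)).trans_le (hM_ge t)
  have hMN : ∀ t, 1 ≤ t → M t ≤ N t := by
    intro t ht
    obtain ⟨n, rfl⟩ := Nat.exists_eq_add_of_le' ht
    rw [hM, hN, Nat.add_sub_cancel]
    refine Finset.sum_le_sum fun z _ => ?_
    rw [Finset.prod_Icc_succ_top ht, ← mul_assoc]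
    exact mul_le_mul_of_nonneg_left (mul_le_of_le_one_right (ha0 _ ht z) (hb1 _ ht z)) (hP n z)
  have hN_pos : ∀ t, 1 ≤ t → 0 < N t := fun t ht => (hM_pos t).trans_le (hMN t ht)
  have hM0 : M 0 = 1 := by simp [hM, hπ1]
  have hbound : ∀ T : ℕ, 1 ≤ T →
      |(1 / (T : ℝ)) * ∑ t ∈ Finset.Icc 1 T, Real.log (M t / N t)| ≤
        (-Real.log (π zstar)) / (T : ℝ) := by
    intro T _
    have hupper : ∑ t ∈ Finset.Icc 1 T, Real.log (M t / N t) ≤ 0 :=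
      Finset.sum_nonpos fun t ht => by
        have ht1 := (Finset.mem_Icc.1 ht).1
        exact Real.log_nonpos (div_pos (hM_pos t) (hN_pos t ht1)).le
          (div_le_one_of_le₀ (hMN t ht1) (hN_pos t ht1).le)
    have hlower := log_sub_log_prod_le_sum_log_div (c := fun t => a t zstar)
      hM0 hM_pos hN_pos haz haM T
    have hlog := Real.log_le_log (mul_pos hπz (hprod T)) (hM_ge T)
    rw [Real.log_mul hπz.ne' (hprod T).ne'] at hlog
    rw [abs_mul, abs_of_nonneg (by positivity : 0 ≤ 1 / (T : ℝ)), abs_of_nonpos hupper,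
      one_div_mul_eq_div]
    gcongr
    linarith
  refine ⟨hbound, squeeze_zero_norm' ?_
    (tendsto_const_div_atTop_nhds_zero_nat (-Real.log (π zstar)))⟩
  filter_upwards [Filter.eventually_ge_atTop 1] with T hT
  exact hbound T hT
end

section
/- Let X and Z be nonempty finite sets, π a prior on Z, and T ≥ 1. Let a : Z → X → ℝ satisfy a z x ≥ 0 and Σ_{x∈X} a z x = 1 for every z (given z, demonstration inputs are i.i.d. with distribution a z), and let b : Z → X → ℝ satisfy 0 ≤ b z x ≤ 1 for all z, x. Fix z* ∈ Z with π z* > 0, a z* x > 0 for all x ∈ X, and b z* x = 1 for all x ∈ X. For a sequence x⃗ = (x_1,…,x_T) ∈ X^T define M_t(x⃗) := Σ_{z∈Z} π z ∏_{i=1}^{t} a z x_i · b z x_i (with M_0(x⃗) = 1) and N_t(x⃗) := Σ_{z∈Z} π z (∏_{i=1}^{t−1} a z x_i · b z x_i) · a z x_t. Then Σ_{x⃗∈X^T} ( ∏_{t=1}^{T} a z* x_t ) · (1/T) Σ_{t=1}^{T} log( M_t(x⃗) / N_t(x⃗) ) ≥ (1/T) log(π z*). That is, the expected average log-likelihood of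 the correct verbalizers, when the T demonstration inputs are drawn i.i.d. from the distribution a z*, is at least (1/T) log π(z*). -/
open Finset in
/-- If `g` has zero mean under resampling coordinate `t` from `p`, then it has zero mean under the
product weights `∏ i, p (v i)`. -/
lemma sum_prod_mul_eq_zero_of_sum_update {X : Type*} [Fintype X] {T : ℕ} (p : X → ℝ)
    (t : Fin T) (g : (Fin T → X) → ℝ)
    (hg : ∀ v, ∑ y, p y * g (Function.update v t y) = 0) :
    ∑ v : Fin T → X, (∏ i, p (v i)) * g v = 0 := by
  obtain _ | n := T
  · exact t.elim0
  rw [← (Fin.insertNthEquiv (fun _ => X) t).sum_comp, Fintype.sum_prod_type, sum_comm]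
  refine sum_eq_zero fun r _ => ?_
  rcases isEmpty_or_nonempty X with hX | ⟨⟨y₀⟩⟩
  · simp
  calc _ = ∑ y, (∏ i, p (r i)) *
        (p y * g (Function.update (t.insertNth y₀ r : Fin (n + 1) → X) t y)) := by
        refine sum_congr rfl fun y _ => ?_
        rw [Fin.prod_univ_succAbove _ t]
        simp only [Fin.insertNthEquiv_apply, Fin.insertNth_apply_same,
          Fin.insertNth_apply_succAbove, Fin.update_insertNth]
        rw [mul_comm (p y), mul_assoc]
        rfl
    _ = 0 := by rw [← mul_sum, hg, mul_zero]

lemma sum_prod_eq_one {X : Type*} [Fintype X] {T : ℕ} (p : X → ℝ) (hp : ∑ x, p x = 1) :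
    ∑ v : Fin T → X, ∏ i, p (v i) = 1 := by
  have h := Finset.prod_univ_sum (fun _ : Fin T => (Finset.univ : Finset X)) (fun _ x => p x)
  simpa [hp] using h.symm

/-- The mixture likelihood `∑ z, π z * ∏ c z (v i)` of the first `k` entries of `v`. -/
noncomputable def prefixLikelihood {X Z : Type*} [Fintype Z] {T : ℕ} (π : Z → ℝ) (c : Z → X → ℝ)
    (v : Fin T → X) (k : ℕ) : ℝ :=
  ∑ z, π z * ∏ i : Fin T with i.val < k, c z (v i)

section PrefixLikelihood

variable {X Z : Type*} [Fintype Z] {T : ℕ} {π : Z → ℝ} {c : Z → X → ℝ}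

lemma prefixLikelihood_zero (hπ : ∑ z, π z = 1) (v : Fin T → X) :
    prefixLikelihood π c v 0 = 1 := by
  simp [prefixLikelihood, hπ]

lemma prefixLikelihood_val (v : Fin T → X) (t : Fin T) :
    prefixLikelihood π c v t = ∑ z, π z * ∏ i ∈ Finset.Iio t, c z (v i) := by
  have h : ({i : Fin T | i.val < t.val} : Finset (Fin T)) = Finset.Iio t := by
    ext i
    simp
  rw [prefixLikelihood, h]

lemma prefixLikelihood_val_succ (v : Fin T → X) (t : Fin T) :
    prefixLikelihood π c v (t + 1) = ∑ z, π z * ∏ i ∈ Finset.Iic t, c z (v i) := by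
  have h : ({i : Fin T | i.val < t.val + 1} : Finset (Fin T)) = Finset.Iic t := by
    ext i
    simp only [Finset.mem_filter_univ, Finset.mem_Iic, Fin.le_iff_val_le_val]
    omega
  rw [prefixLikelihood, h]

lemma prefixLikelihood_length (v : Fin T → X) :
    prefixLikelihood π c v T = ∑ z, π z * ∏ i, c z (v i) := by
  simp [prefixLikelihood]

lemma prefixLikelihood_update (v : Fin T → X) (t : Fin T) (y : X) :
    prefixLikelihood π c (Function.update v t y) t = prefixLikelihood π c v t := by
  refine Finset.sum_congr rfl fun z _ => ?_
  congr 1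
  refine Finset.prod_congr rfl fun i hi => ?_
  have hne : i ≠ t := by
    rintro rfl
    simp at hi
  rw [Function.update_of_ne hne]

lemma prefixLikelihood_pos (hπ : ∀ z, 0 ≤ π z) (hc : ∀ z x, 0 ≤ c z x) {z₀ : Z}
    (hπz : 0 < π z₀) (hcz : ∀ x, 0 < c z₀ x) (v : Fin T → X) (k : ℕ) :
    0 < prefixLikelihood π c v k :=
  Finset.sum_pos' (fun z _ => mul_nonneg (hπ z) (Finset.prod_nonneg fun _ _ => hc z _))
    ⟨z₀, Finset.mem_univ _, mul_pos hπz (Finset.prod_pos fun _ _ => hcz _)⟩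

lemma log_add_sum_log_le_log_prefixLikelihood (hπ : ∀ z, 0 ≤ π z) (hc : ∀ z x, 0 ≤ c z x) {z₀ : Z}
    (hπz : 0 < π z₀) (hcz : ∀ x, 0 < c z₀ x) (v : Fin T → X) :
    Real.log (π z₀) + ∑ i, Real.log (c z₀ (v i)) ≤ Real.log (prefixLikelihood π c v T) := by
  have hprod : 0 < ∏ i, c z₀ (v i) := Finset.prod_pos fun _ _ => hcz _
  rw [← Real.log_prod fun i _ => (hcz _).ne', ← Real.log_mul hπz.ne' hprod.ne']
  refine Real.log_le_log (mul_pos hπz hprod) ?_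
  rw [prefixLikelihood_length]
  exact Finset.single_le_sum (f := fun z => π z * ∏ i, c z (v i))
    (fun z _ => mul_nonneg (hπ z) (Finset.prod_nonneg fun _ _ => hc z _)) (Finset.mem_univ z₀)

lemma sum_log_prefixLikelihood_succ_sub (hπ : ∑ z, π z = 1) (v : Fin T → X) :
    ∑ t : Fin T, (Real.log (prefixLikelihood π c v (t + 1)) -
      Real.log (prefixLikelihood π c v t)) = Real.log (prefixLikelihood π c v T) := by
  rw [Fin.sum_univ_eq_sum_range (fun k => Real.log (prefixLikelihood π c v (k + 1)) -
    Real.log (prefixLikelihood π c v k)) T,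
    Finset.sum_range_sub (fun k => Real.log (prefixLikelihood π c v k)),
    prefixLikelihood_zero hπ, Real.log_one, sub_zero]

end PrefixLikelihood

/-- Corollary 1 (Expected Average ICL Loss) of the Pelican Soup paper: when the
`T` demonstration inputs are drawn i.i.d. from the true input distribution
`a zstar` (so sub-sequences separated by the delimiter are independent given
`zstar`), the expected average log-likelihood of the correct verbalizers is at
least `(1/T) * log (π zstar)`.  Demonstration sequences are indexed by
`Fin T` (position `t : Fin T` is the `(t+1)`-st example), `M t xv`
is the marginal likelihood of the first `t+1` examples and `N t xv` that of
the first `t` examples followed by the `(t+1)`-st input. -/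
theorem pelican_soup_expected_average_icl_loss
    {X Z : Type*} [Fintype X] [Nonempty X] [Fintype Z] [Nonempty Z]
    (π : Z → ℝ) (hπ0 : ∀ z, 0 ≤ π z) (hπ1 : ∑ z, π z = 1)
    (T : ℕ) (hT : 1 ≤ T)
    (a : Z → X → ℝ)
    (ha0 : ∀ z x, 0 ≤ a z x) (ha1 : ∀ z, ∑ x, a z x = 1)
    (b : Z → X → ℝ)
    (hb0 : ∀ z x, 0 ≤ b z x) (hb1 : ∀ z x, b z x ≤ 1)
    (zstar : Z) (hπz : 0 < π zstar)
    (haz : ∀ x, 0 < a zstar x)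
    (hbz : ∀ x, b zstar x = 1)
    (M N : Fin T → (Fin T → X) → ℝ)
    (hM : ∀ t xv, M t xv = ∑ z, π z * ∏ i ∈ Finset.Iic t, (a z (xv i) * b z (xv i)))
    (hN : ∀ t xv, N t xv =
      ∑ z, π z * (∏ i ∈ Finset.Iio t, (a z (xv i) * b z (xv i))) * a z (xv t)) :
    ∑ xv : Fin T → X,
        (∏ t, a zstar (xv t)) *
          ((1 / (T : ℝ)) * ∑ t, Real.log (M t xv / N t xv)) ≥
      (1 / (T : ℝ)) * Real.log (π zstar) := by
  set c : Z → X → ℝ := fun z x => a z x * b z x with hc_def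
  have hc0 : ∀ z x, 0 ≤ c z x := fun z x => mul_nonneg (ha0 z x) (hb0 z x)
  have hcz : ∀ x, c zstar x = a zstar x := fun x => by simp [hc_def, hbz]
  have hcz_pos : ∀ x, 0 < c zstar x := fun x => hcz x ▸ haz x
  have hM' : ∀ t v, M t v = prefixLikelihood π c v (t + 1) := fun t v => by
    rw [hM, prefixLikelihood_val_succ]
  have hD_pos : ∀ v k, 0 < prefixLikelihood π c (T := T) v k := fun v k =>
    prefixLikelihood_pos hπ0 hc0 hπz hcz_pos v k
  have hN_pos : ∀ t v, 0 < N t v := fun t v => by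
    rw [hN]
    exact Finset.sum_pos'
      (fun z _ => mul_nonneg (mul_nonneg (hπ0 z) (Finset.prod_nonneg fun _ _ => hc0 z _)) (ha0 z _))
      ⟨zstar, Finset.mem_univ _,
        mul_pos (mul_pos hπz (Finset.prod_pos fun _ _ => hcz_pos _)) (haz _)⟩
  have hN_sum : ∀ t v, ∑ y, N t (Function.update v t y) = prefixLikelihood π c v t := by
    intro t v
    have hN_update : ∀ y, N t (Function.update v t y) =
        ∑ z, π z * (∏ i ∈ Finset.Iio t, c z (v i)) * a z y := by
      intro y
      rw [hN]
      refine Finset.sum_congr rfl fun z _ => ?_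
      rw [Function.update_self]
      congr 2
      refine Finset.prod_congr rfl fun i hi => ?_
      rw [Function.update_of_ne (Finset.mem_Iio.mp hi).ne]
    simp_rw [hN_update]
    rw [Finset.sum_comm, prefixLikelihood_val]
    simp_rw [← Finset.mul_sum, ha1, mul_one]
  -- `g t` bounds from below the log-ratio of the true to the predictive input probability.
  set g : Fin T → (Fin T → X) → ℝ :=
    fun t v => 1 - N t v / (prefixLikelihood π c v t * a zstar (v t)) with hg_def
  have hg_mean : ∀ t, ∑ v : Fin T → X, (∏ i, a zstar (v i)) * g t v = 0 := by
    refine fun t => sum_prod_mul_eq_zero_of_sum_update _ t _ fun v => ?_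
    have hterm : ∀ y, a zstar y * g t (Function.update v t y) =
        a zstar y - N t (Function.update v t y) / prefixLikelihood π c v t := by
      intro y
      simp only [hg_def, prefixLikelihood_update, Function.update_self]
      have := (haz y).ne'
      have := (hD_pos v t).ne'
      field_simp
    simp_rw [hterm]
    rw [Finset.sum_sub_distrib, ha1, ← Finset.sum_div, hN_sum, div_self (hD_pos v t).ne', sub_self]
  have hpointwise : ∀ v, Real.log (π zstar) + ∑ t, g t v ≤ ∑ t, Real.log (M t v / N t v) := by
    intro v
    have hterm : ∀ t : Fin T, Real.log (prefixLikelihood π c v (t + 1)) -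
        Real.log (prefixLikelihood π c v t) - Real.log (c zstar (v t)) + g t v ≤
        Real.log (M t v / N t v) := by
      intro t
      have hpos := mul_pos (hD_pos v t) (haz (v t))
      have hlog := Real.log_le_sub_one_of_pos (div_pos (hN_pos t v) hpos)
      rw [Real.log_div (hN_pos t v).ne' hpos.ne',
        Real.log_mul (hD_pos v t).ne' (haz _).ne'] at hlog
      rw [hM', Real.log_div (hD_pos v _).ne' (hN_pos t v).ne', hcz]
      simp only [hg_def]
      linarith
    have hsum := Finset.sum_le_sum fun t (_ : t ∈ Finset.univ) => hterm t
    rw [Finset.sum_add_distrib, Finset.sum_sub_distrib,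
      sum_log_prefixLikelihood_succ_sub hπ1] at hsum
    linarith [log_add_sum_log_le_log_prefixLikelihood hπ0 hc0 hπz hcz_pos v]
  calc (1 / (T : ℝ)) * Real.log (π zstar)
      = (1 / (T : ℝ)) * ((∑ v : Fin T → X, ∏ i, a zstar (v i)) * Real.log (π zstar) +
          ∑ t, ∑ v : Fin T → X, (∏ i, a zstar (v i)) * g t v) := by
        simp [hg_mean, sum_prod_eq_one _ (ha1 zstar)]
    _ = ∑ v : Fin T → X, (∏ t, a zstar (v t)) *
          ((1 / (T : ℝ)) * (Real.log (π zstar) + ∑ t, g t v)) := by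
        rw [Finset.sum_comm, Finset.sum_mul, ← Finset.sum_add_distrib, Finset.mul_sum]
        refine Finset.sum_congr rfl fun v _ => ?_
        rw [← Finset.mul_sum]
        ring
    _ ≤ _ := by
        refine Finset.sum_le_sum fun v _ => ?_
        refine mul_le_mul_of_nonneg_left ?_ (Finset.prod_nonneg fun _ _ => ha0 _ _)
        exact mul_le_mul_of_nonneg_left (hpointwise v) (by positivity)
end

section
/- Let Π be a nonempty finite set of reasoning chains, ℓ : Π → ℕ a length function, and p_min, p_drop ∈ ℝ with 0 < p_min ≤ 1 and 0 < p_drop ≤ 1. Let q : Π → ℝ satisfy q π ≥ 0 for all π ∈ Π, and suppose there is a chain π* ∈ Π with q π* ≥ p_min ^ (ℓ π*). Then log( Σ_{π∈Π} q π · p_drop ^ (ℓ π) ) ≥ (ℓ π*) · ( log p_min + log p_drop ). -/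
/-- The bound from Section 5 and the appendix of the Pelican Soup paper
relating the ICL likelihood of an example to the number of reasoning steps:
for a finite set of reasoning chains with length function `ℓ`, chain
probabilities `q`, per-step lower bound `pmin`, and per-step drop probability
`pdrop`, if some chain `cstar` satisfies `q cstar ≥ pmin ^ ℓ cstar`, then
`log (∑ c, q c * pdrop ^ ℓ c) ≥ ℓ cstar * (log pmin + log pdrop)`. -/
theorem pelican_soup_description_length_bound
    {C : Type*} [Fintype C] [Nonempty C]
    (ℓ : C → ℕ)
    (pmin pdrop : ℝ)
    (hpmin0 : 0 < pmin) (hpmin1 : pmin ≤ 1)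
    (hpdrop0 : 0 < pdrop) (hpdrop1 : pdrop ≤ 1)
    (q : C → ℝ) (hq0 : ∀ c, 0 ≤ q c)
    (cstar : C) (hcstar : pmin ^ (ℓ cstar) ≤ q cstar) :
    Real.log (∑ c, q c * pdrop ^ (ℓ c)) ≥
      (ℓ cstar : ℝ) * (Real.log pmin + Real.log pdrop) := by
  have hle : (pmin * pdrop) ^ ℓ cstar ≤ ∑ c, q c * pdrop ^ ℓ c :=
    calc (pmin * pdrop) ^ ℓ cstar = pmin ^ ℓ cstar * pdrop ^ ℓ cstar := mul_pow _ _ _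
      _ ≤ q cstar * pdrop ^ ℓ cstar := by gcongr
      _ ≤ ∑ c, q c * pdrop ^ ℓ c :=
        Finset.single_le_sum (f := fun c => q c * pdrop ^ ℓ c)
          (fun c _ => mul_nonneg (hq0 c) (by positivity)) (Finset.mem_univ cstar)
  have hlog := Real.log_le_log (by positivity) hle
  rwa [Real.log_pow, Real.log_mul hpmin0.ne' hpdrop0.ne'] at hlog
end
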